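/- Let $(X,\mathcal{B},\mu,f,T_f)$ be a dissipative composition dynamical system of bounded distortion generated by $W$, with $T_f$ invertible on $L^p(X)$, $1\le p<\infty$. Let $B_w$ be the bilateral weighted backward shift on $\ell^p(\mathbb{Z})$ with weights $w_k=\left(\frac{\mu(f^{k-1}(W))}{\mu(f^k(W))}\right)^{1/p}$. If $B_w$ is strongly structurally stable, then $T_f$ is strongly structurally stable. -/

import Mathlib

open MeasureTheory Filter Set ENNReal

/-- Strong structural stability. -/
def StronglyStructurallyStable {E : Type*} [NormedAddCommGroup E]
    [NormedSpace ℂ E] (T : E ≃L[ℂ] E) : Prop :=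
  ∀ γ : ℝ, 0 < γ → ∃ ε : ℝ, 0 < ε ∧ ∀ φ : E → E, Continuous φ →
    (∀ x, ‖φ x‖ ≤ ε) → LipschitzWith (Real.toNNReal ε) φ →
    ∃ h : E ≃ₜ E, (∀ x, h (T x) = T (h x) + φ (h x)) ∧ ∀ x, ‖h x - x‖ ≤ γ

section GreenKernel

theorem Homeomorph.zpow_semiconj {E : Type*} [TopologicalSpace E] {τ σ : E ≃ₜ E} {h : E → E}
    (H : ∀ x, h (τ x) = σ (h x)) (n : ℤ) (x : E) : h ((τ ^ n) x) = (σ ^ n) (h x) := by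
  induction n generalizing x with
  | zero => simp [Homeomorph.one_apply]
  | succ n ih => rw [zpow_add_one, zpow_add_one, Homeomorph.mul_apply, Homeomorph.mul_apply, ih, H]
  | pred n ih =>
    have H' : h (τ⁻¹ x) = σ⁻¹ (h x) := by
      have h1 : σ (h (τ⁻¹ x)) = h x := by
        rw [← H, ← Homeomorph.mul_apply, mul_inv_cancel, Homeomorph.one_apply]
      rw [← h1, ← Homeomorph.mul_apply, inv_mul_cancel, Homeomorph.one_apply]
    rw [zpow_sub_one, zpow_sub_one, Homeomorph.mul_apply, Homeomorph.mul_apply, ih, H']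

theorem eq_zero_of_norm_le_half {α F : Type*} [NormedAddCommGroup F] {d : α → F} {D : ℝ}
    (hd : ∀ x, ‖d x‖ ≤ D) (h : ∀ M, (∀ x, ‖d x‖ ≤ M) → ∀ x, ‖d x‖ ≤ 1 / 2 * M) (x : α) :
    d x = 0 := by
  have : Nonempty α := ⟨x⟩
  have hbdd : BddAbove (range fun x => ‖d x‖) := ⟨D, by rintro _ ⟨x, rfl⟩; exact hd x⟩
  have h1 := h _ (le_ciSup hbdd)
  have h2 : (⨆ x, ‖d x‖) ≤ 1 / 2 * ⨆ x, ‖d x‖ := ciSup_le h1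
  have h3 : ‖d x‖ ≤ ⨆ x, ‖d x‖ := le_ciSup hbdd x
  exact norm_le_zero_iff.1 (by linarith)

variable {E : Type*} [NormedAddCommGroup E] [NormedSpace ℂ E]

/-- The convolution of the kernel `G` with the sequence `n ↦ y (τ ^ n x)`, evaluated at time `0`. -/
noncomputable def greenSum (G : ℤ → E →L[ℂ] E) (τ : E ≃ₜ E) (y : E → E) (x : E) : E :=
  ∑' k : ℤ, G k (y ((τ ^ (-k)) x))

variable {G : ℤ → E →L[ℂ] E} {ε : ℝ} {y y' : E → E}

theorem norm_kernel_apply_le (hy : ∀ x, ‖y x‖ ≤ ε) (k : ℤ) (x : E) :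
    ‖G k (y x)‖ ≤ ‖G k‖ * ε :=
  ((G k).le_opNorm _).trans (mul_le_mul_of_nonneg_left (hy _) (norm_nonneg _))

theorem norm_greenSum_le (hG : Summable fun k => ‖G k‖) (τ : E ≃ₜ E)
    (hy : ∀ x, ‖y x‖ ≤ ε) (x : E) : ‖greenSum G τ y x‖ ≤ (∑' k, ‖G k‖) * ε :=
  tsum_of_norm_bounded (hG.hasSum.mul_right ε) fun _ => norm_kernel_apply_le hy _ _

variable [CompleteSpace E]

theorem continuous_greenSum (hG : Summable fun k => ‖G k‖) (τ : E ≃ₜ E) (hyc : Continuous y)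
    (hy : ∀ x, ‖y x‖ ≤ ε) : Continuous (greenSum G τ y) :=
  continuous_tsum (fun k => (G k).continuous.comp (hyc.comp (τ ^ (-k)).continuous))
    (hG.mul_right ε) fun _ _ => norm_kernel_apply_le hy _ _

theorem summable_greenSum (hG : Summable fun k => ‖G k‖) (τ : E ≃ₜ E)
    (hy : ∀ x, ‖y x‖ ≤ ε) (x : E) : Summable fun k : ℤ => G k (y ((τ ^ (-k)) x)) :=
  .of_norm_bounded (hG.mul_right ε) fun _ => norm_kernel_apply_le hy _ _

theorem greenSum_sub (hG : Summable fun k => ‖G k‖) (τ : E ≃ₜ E)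
    (hy : ∀ x, ‖y x‖ ≤ ε) (hy' : ∀ x, ‖y' x‖ ≤ ε) (x : E) :
    greenSum G τ y x - greenSum G τ y' x = greenSum G τ (y - y') x := by
  rw [greenSum, greenSum, ← (summable_greenSum hG τ hy x).tsum_sub (summable_greenSum hG τ hy' x)]
  simp [greenSum]

theorem greenSum_apply_self {T : E ≃L[ℂ] E} (hG : Summable fun k => ‖G k‖)
    (hGT : ∀ k x, G (k + 1) x = T (G k x) + if k = 0 then x else 0) (τ : E ≃ₜ E)
    (hy : ∀ x, ‖y x‖ ≤ ε) (x : E) :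
    greenSum G τ y (τ x) = T (greenSum G τ y x) + y x := by
  have hs := summable_greenSum hG τ hy x
  have hk (k : ℤ) : G (k + 1) (y ((τ ^ (-(k + 1))) (τ x))) =
      T (G k (y ((τ ^ (-k)) x))) + if k = 0 then y x else 0 := by
    rw [← Homeomorph.mul_apply, ← zpow_add_one, neg_add, neg_add_cancel_right, hGT]
    split_ifs with h
    · subst h; simp [Homeomorph.one_apply]
    · rfl
  have hT : HasSum (fun k : ℤ => T (G k (y ((τ ^ (-k)) x)))) (T (greenSum G τ y x)) :=
    (T : E →L[ℂ] E).hasSum hs.hasSum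
  have h0 : HasSum (fun k : ℤ => if k = 0 then y x else 0) (y x) := hasSum_ite_eq 0 (y x)
  have := (hT.add h0).tsum_eq
  simp only [← hk] at this
  rw [← this]
  exact ((Equiv.addRight (1 : ℤ)).tsum_eq fun k => G k (y ((τ ^ (-k)) (τ x)))).symm

/-- A contraction argument: the equation `u = greenSum G τ (φ ∘ (id + u))` is solvable. -/
theorem exists_continuous_eq_greenSum (hG : Summable fun k => ‖G k‖) (τ : E ≃ₜ E) {φ : E → E}
    (hφc : Continuous φ) (hφ : ∀ x, ‖φ x‖ ≤ ε) (hφL : ∀ x y, ‖φ x - φ y‖ ≤ ε * ‖x - y‖)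
    (hε : 0 ≤ ε) (hGε : (∑' k, ‖G k‖) * ε ≤ 1 / 2) :
    ∃ u : E → E, Continuous u ∧ ∀ x, u x = greenSum G τ (fun x => φ (x + u x)) x := by
  let Ψ : BoundedContinuousFunction E E → BoundedContinuousFunction E E := fun u =>
    .ofNormedAddCommGroup (greenSum G τ fun x => φ (x + u x))
      (continuous_greenSum hG τ (hφc.comp (continuous_id.add u.continuous)) fun _ => hφ _)
      ((∑' k, ‖G k‖) * ε) (norm_greenSum_le hG τ fun _ => hφ _)
  have hΨ : ContractingWith (1 / 2) Ψ := by
    refine ⟨by norm_num, LipschitzWith.of_dist_le_mul fun u v => ?_⟩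
    refine (BoundedContinuousFunction.dist_le (by positivity)).2 fun x => ?_
    rw [dist_eq_norm]
    change ‖greenSum G τ (fun x => φ (x + u x)) x - greenSum G τ (fun x => φ (x + v x)) x‖ ≤ _
    rw [greenSum_sub hG τ (fun _ => hφ _) (fun _ => hφ _)]
    refine (norm_greenSum_le hG τ (ε := ε * dist u v) (fun z => ?_) x).trans ?_
    · refine (hφL _ _).trans (mul_le_mul_of_nonneg_left ?_ hε)
      rw [add_sub_add_left_eq_sub, ← dist_eq_norm]
      exact u.dist_coe_le_dist z
    · rw [← mul_assoc]
      exact mul_le_mul_of_nonneg_right (by simpa using hGε) dist_nonneg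
  refine ⟨hΨ.fixedPoint, (hΨ.fixedPoint).continuous, fun x => ?_⟩
  exact (DFunLike.congr_fun hΨ.fixedPoint_isFixedPt x).symm

/-- An invertible operator whose difference equation `u (n + 1) = T (u n) + y n` has a summable
Green kernel is strongly structurally stable. -/
theorem StronglyStructurallyStable.of_green_kernel {T : E ≃L[ℂ] E}
    (hG : Summable fun k => ‖G k‖)
    (hGT : ∀ k x, G (k + 1) x = T (G k x) + if k = 0 then x else 0) :
    StronglyStructurallyStable T := by
  intro γ hγ
  set C := ∑' k, ‖G k‖
  have hC0 : 0 ≤ C := tsum_nonneg fun _ => norm_nonneg _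
  set N := ‖(T.symm : E →L[ℂ] E)‖ with hN
  have hN0 : 0 ≤ N := norm_nonneg _
  obtain ⟨ε, hε, hεγ, hεC, hεN⟩ : ∃ ε : ℝ, 0 < ε ∧ C * ε ≤ γ ∧ C * ε ≤ 1 / 2 ∧ N * ε ≤ 1 / 2 := by
    refine ⟨min γ (1 / 2) / (C + N + 1), by positivity, ?_, ?_, ?_⟩ <;>
    · rw [mul_div_assoc', div_le_iff₀ (by positivity)]
      have := min_le_left γ (1 / 2)
      have := min_le_right γ (1 / 2)
      have : 0 ≤ min γ (1 / 2) := by positivity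
      nlinarith [mul_nonneg hC0 hγ.le, mul_nonneg hN0 hγ.le]
  refine ⟨ε, hε, fun φ hφc hφ hφL => ?_⟩
  have hφL' (x y : E) : ‖φ x - φ y‖ ≤ ε * ‖x - y‖ := by
    simpa [dist_eq_norm, hε.le] using hφL.dist_le_mul x y
  let τ : E ≃ₜ E := T.toHomeomorph
  have happ : ApproximatesLinearOn (fun x => T x + φ x) (T : E →L[ℂ] E) univ (Real.toNNReal ε) := by
    intro x _ y _
    simpa [add_sub_add_comm, hε.le] using hφL' x y
  have hsub : Subsingleton E ∨ Real.toNNReal ε < ‖(T.symm : E →L[ℂ] E)‖₊⁻¹ := by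
    rcases subsingleton_or_nontrivial E with h | h
    · exact .inl h
    · right
      have hpos : 0 < N := T.norm_symm_pos
      rw [← NNReal.coe_lt_coe, NNReal.coe_inv, coe_nnnorm, Real.coe_toNNReal _ hε.le, ← hN,
        lt_inv_comm₀ hε hpos, ← one_div, lt_div_iff₀ hε]
      linarith
  let σ : E ≃ₜ E := happ.toHomeomorph _ hsub
  have hτ (x : E) : τ x = T x := rfl
  have hσ (x : E) : σ x = T x + φ x := rfl
  obtain ⟨u, huc, hu⟩ := exists_continuous_eq_greenSum hG τ hφc hφ hφL' hε.le hεC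
  let v : E → E := greenSum G σ φ
  have hvc : Continuous v := continuous_greenSum hG σ hφc hφ
  have hub (x : E) : ‖u x‖ ≤ C * ε := hu x ▸ norm_greenSum_le hG τ (fun _ => hφ _) x
  have hvb (x : E) : ‖v x‖ ≤ C * ε := norm_greenSum_le hG σ hφ x
  have hh (x : E) : τ x + u (τ x) = σ (x + u x) := by
    rw [hu (τ x), greenSum_apply_self hG hGT τ (fun _ => hφ _), ← hu x, hτ, hσ, map_add, add_assoc]
  have hk (x : E) : σ x - v (σ x) = τ (x - v x) := by
    change σ x - greenSum G σ φ (σ x) = _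
    rw [greenSum_apply_self hG hGT σ hφ, hτ, hσ, map_sub]
    change _ = T x - T (greenSum G σ φ x)
    abel
  have hvu (x : E) : v (x + u x) = u x := by
    rw [hu x]
    conv_lhs => rw [← hu x]
    refine tsum_congr fun k => ?_
    rw [← Homeomorph.zpow_semiconj (h := fun x => x + u x) hh]
  have huv (x : E) : u (x - v x) - v x = 0 := by
    refine eq_zero_of_norm_le_half (d := fun x => u (x - v x) - v x) (D := C * ε + C * ε)
      (fun x => (norm_sub_le _ _).trans (add_le_add (hub _) (hvb _))) (fun M hM x => ?_) x
    have h1 : u (x - v x) = greenSum G σ (fun z => φ (z - v z + u (z - v z))) x := by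
      rw [hu]
      refine tsum_congr fun k => ?_
      rw [← Homeomorph.zpow_semiconj (h := fun x => x - v x) hk]
    have hM0 : 0 ≤ M := (norm_nonneg _).trans (hM x)
    rw [h1]
    change ‖_ - greenSum G σ φ x‖ ≤ _
    rw [greenSum_sub hG σ (fun _ => hφ _) hφ]
    refine (norm_greenSum_le hG σ (ε := ε * M) (fun z => ?_) x).trans ?_
    · refine (hφL' _ _).trans (mul_le_mul_of_nonneg_left ?_ hε.le)
      refine le_of_eq_of_le (congrArg norm ?_) (hM z)
      abel
    · rw [← mul_assoc]
      exact mul_le_mul_of_nonneg_right hεC hM0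
  refine ⟨⟨⟨fun x => x + u x, fun x => x - v x, fun x => ?_, fun x => ?_⟩,
    continuous_id.add huc, continuous_id.sub hvc⟩, hh, fun x => ?_⟩
  · simp [hvu]
  · have := huv x
    rw [sub_eq_zero] at this
    simp [this]
  · simpa using (hub x).trans hεγ

end GreenKernel

section Weights

theorem Int.exists_primitive (q : ℤ → ℝ) : ∃ F : ℤ → ℝ, ∀ n, F (n + 1) = F n + q n := by
  refine ⟨fun n => ∑ i ∈ Finset.Ico 0 n, q i - ∑ i ∈ Finset.Ico n 0, q i, fun n => ?_⟩
  dsimp only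
  rcases le_or_gt 0 n with h | h
  · rw [Finset.Ico_eq_empty_of_le h, Finset.Ico_eq_empty_of_le (show (0 : ℤ) ≤ n + 1 by omega),
      ← Finset.insert_Ico_right_eq_Ico_add_one h, Finset.sum_insert (by simp)]
    simp [add_comm]
  · rw [Finset.Ico_eq_empty_of_le h.le, Finset.Ico_eq_empty_of_le (show n + 1 ≤ (0 : ℤ) by omega),
      ← Finset.insert_Ico_add_one_left_eq_Ico h, Finset.sum_insert (by simp)]
    simp

/-- If a positive sequence bounds its own partial sums from the two endpoints, then around every
index it grows geometrically in one of the two directions. -/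
theorem exists_geometric_growth {q : ℤ → ℝ} (hq : ∀ n, 0 < q n) {ε : ℝ} (hε : 0 < ε)
    (h : ∀ (l : ℤ) (N : ℕ), ε * ∑ m ∈ Finset.range N, q (l + m) ≤ q l + q (l + N)) :
    ∃ C r : ℝ, 0 < C ∧ 0 < r ∧ r < 1 ∧
      ∀ n, (∀ k : ℕ, q n ≤ C * r ^ k * q (n + 1 + k)) ∨ ∀ k : ℕ, q n ≤ C * r ^ k * q (n - k) := by
  obtain ⟨F, hF⟩ := Int.exists_primitive q
  have hFN (l : ℤ) (N : ℕ) : F (l + N) - F l = ∑ m ∈ Finset.range N, q (l + m) := by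
    induction N with
    | zero => simp
    | succ N ih =>
      rw [Finset.sum_range_succ, ← ih, Nat.cast_succ, ← add_assoc, hF]
      ring
  have hmono : Monotone F := monotone_int_of_le_succ fun n => by rw [hF]; linarith [hq n]
  have hpair (l m : ℤ) : ε * F m - q m ≤ ε * F l + q l := by
    rcases le_total l m with hlm | hlm
    · obtain ⟨N, rfl⟩ := Int.le.dest hlm
      have := h l N
      rw [← hFN] at this
      linarith
    · have := mul_le_mul_of_nonneg_left (hmono hlm) hε.le
      linarith [hq l, hq m]
  set v := ⨆ n, (ε * F n - q n)
  have hbdd : BddAbove (range fun n => ε * F n - q n) :=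
    ⟨ε * F 0 + q 0, by rintro _ ⟨n, rfl⟩; exact hpair 0 n⟩
  have hv1 (n : ℤ) : ε * F n - v ≤ q n := by linarith [le_ciSup hbdd n]
  have hv2 (n : ℤ) : v - ε * F n ≤ q n := by linarith [ciSup_le (hpair n)]
  have hstep (n : ℤ) : ε * F (n + 1) = ε * F n + ε * q n := by rw [hF]; ring
  have hr0 : 0 < (1 + ε)⁻¹ := by positivity
  refine ⟨2 / ε, (1 + ε)⁻¹, by positivity, hr0, inv_lt_one_of_one_lt₀ (by linarith),
    fun n => ?_⟩
  have key {A B : ℝ} (k : ℕ) (hB : (1 + ε) ^ k * (ε * A / 2) ≤ B) :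
      A ≤ 2 / ε * (1 + ε)⁻¹ ^ k * B := by
    rw [inv_pow, ← div_eq_mul_inv, div_div, div_mul_eq_mul_div, le_div_iff₀ (by positivity)]
    linarith
  rcases le_total (ε * q n / 2) (ε * F (n + 1) - v) with hn | hn
  · refine .inl fun k => key k (le_trans ?_ (hv1 _))
    induction k with
    | zero => simpa using hn
    | succ k ih =>
      rw [Nat.cast_succ, ← add_assoc, hstep, pow_succ]
      have := mul_le_mul_of_nonneg_left (hv1 (n + 1 + k)) hε.le
      have := mul_le_mul_of_nonneg_left ih (show 0 ≤ 1 + ε by linarith)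
      linarith
  · replace hn : ε * q n / 2 ≤ v - ε * F n := by linarith [hstep n]
    refine .inr fun k => key k (le_trans ?_ (hv2 _))
    induction k with
    | zero => simpa using hn
    | succ k ih =>
      have h1 := hstep (n - (k + 1))
      rw [show n - ((k : ℤ) + 1) + 1 = n - k by ring] at h1
      rw [Nat.cast_succ, pow_succ]
      have h2 : v - ε * F (n - k) ≤ q (n - (k + 1)) := by
        linarith [hv2 (n - (k + 1)), mul_pos hε (hq (n - (k + 1)))]
      have := mul_le_mul_of_nonneg_left h2 hε.le
      have := mul_le_mul_of_nonneg_left ih (show 0 ≤ 1 + ε by linarith)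
      linarith

end Weights

section Shadowing

variable {E : Type*} [NormedAddCommGroup E] [NormedSpace ℂ E]

/-- The radial retraction onto the closed unit ball. -/
noncomputable def radialRetraction (x : E) : E := ((max 1 ‖x‖)⁻¹ : ℝ) • x

theorem norm_radialRetraction_le_one (x : E) : ‖radialRetraction x‖ ≤ 1 := by
  have h : 0 < max 1 ‖x‖ := by positivity
  rw [radialRetraction, norm_smul, Real.norm_of_nonneg (by positivity), inv_mul_le_iff₀ h, mul_one]
  exact le_max_right _ _

theorem norm_radialRetraction_sub_le (x y : E) :
    ‖radialRetraction x - radialRetraction y‖ ≤ 2 * ‖x - y‖ := by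
  unfold radialRetraction
  set X := max 1 ‖x‖ with hX
  set Y := max 1 ‖y‖ with hY
  have hX1 : 1 ≤ X := le_max_left _ _
  have hY1 : 1 ≤ Y := le_max_left _ _
  have hXY : |Y - X| ≤ ‖x - y‖ := by
    rw [hX, hY, max_comm 1 ‖y‖, max_comm 1 ‖x‖, norm_sub_rev]
    exact (abs_max_sub_max_le_abs _ _ _).trans (abs_norm_sub_norm_le y x)
  have hdecomp : X⁻¹ • x - Y⁻¹ • y = X⁻¹ • (x - y) + (X⁻¹ * (Y - X)) • (Y⁻¹ • y) := by
    have : X⁻¹ * (Y - X) * Y⁻¹ = X⁻¹ - Y⁻¹ := by field_simp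
    rw [smul_smul, this, sub_smul, smul_sub]
    abel
  have hXi : X⁻¹ ≤ 1 := inv_le_one_of_one_le₀ hX1
  have hXi0 : 0 ≤ X⁻¹ := by positivity
  have hy : ‖Y⁻¹ • y‖ ≤ 1 := norm_radialRetraction_le_one y
  rw [hdecomp]
  refine (norm_add_le _ _).trans ?_
  rw [norm_smul, norm_smul, norm_mul, Real.norm_of_nonneg hXi0, Real.norm_eq_abs]
  have h1 : X⁻¹ * ‖x - y‖ ≤ 1 * ‖x - y‖ := by gcongr
  have h2 : X⁻¹ * |Y - X| * ‖Y⁻¹ • y‖ ≤ 1 * ‖x - y‖ * 1 := by gcongr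
  linarith

/-- A strongly structurally stable operator shadows its pseudo-orbits outside the unit ball whose
errors are the images of the normalized points, scaled by a fixed small factor. -/
theorem StronglyStructurallyStable.exists_shadowing {T : E ≃L[ℂ] E}
    (hT : StronglyStructurallyStable T) :
    ∃ δ : ℝ, 0 < δ ∧ ∀ x : ℕ → E, ∀ N : ℕ,
      (∀ n < N, 1 ≤ ‖x n‖ ∧ x (n + 1) = T (x n) + (δ : ℂ) • T ((‖x n‖ : ℂ)⁻¹ • x n)) →
      ∃ z, ∀ n ≤ N, ‖x n - (T ^ n) z‖ ≤ 1 := by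
  obtain ⟨ε, hε, hε'⟩ := hT 1 one_pos
  set A := ‖(T : E →L[ℂ] E)‖
  have hA0 : 0 ≤ A := norm_nonneg _
  have hTle (x : E) : ‖T x‖ ≤ A * ‖x‖ := (T : E →L[ℂ] E).le_opNorm x
  obtain ⟨δ, hδ, hδA⟩ : ∃ δ : ℝ, 0 < δ ∧ δ * (2 * A) ≤ ε := by
    refine ⟨ε / (2 * A + 1), by positivity, ?_⟩
    rw [div_mul_eq_mul_div, div_le_iff₀ (by positivity)]
    linarith
  refine ⟨δ, hδ, fun x N hx => ?_⟩
  have hφL : LipschitzWith ε.toNNReal fun x => δ • T (radialRetraction x) := by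
    refine LipschitzWith.of_dist_le_mul fun x y => ?_
    rw [dist_eq_norm, dist_eq_norm, ← smul_sub, ← map_sub, norm_smul, Real.norm_of_nonneg hδ.le,
      Real.coe_toNNReal _ hε.le]
    calc δ * ‖T (radialRetraction x - radialRetraction y)‖
        ≤ δ * (A * (2 * ‖x - y‖)) := by
          gcongr
          exact (hTle _).trans (by gcongr; exact norm_radialRetraction_sub_le x y)
      _ = δ * (2 * A) * ‖x - y‖ := by ring
      _ ≤ ε * ‖x - y‖ := by gcongr
  have hφ (x : E) : ‖δ • T (radialRetraction x)‖ ≤ ε := by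
    rw [norm_smul, Real.norm_of_nonneg hδ.le]
    calc δ * ‖T (radialRetraction x)‖ ≤ δ * (A * 1) := by
          gcongr
          exact (hTle _).trans (by gcongr; exact norm_radialRetraction_le_one x)
      _ ≤ δ * (2 * A) := mul_le_mul_of_nonneg_left (by linarith) hδ.le
      _ ≤ ε := hδA
  obtain ⟨h, hconj, hh⟩ := hε' _ hφL.continuous hφ hφL
  have horbit (n : ℕ) (hn : n ≤ N) : x n = h ((T ^ n) (h.symm (x 0))) := by
    induction n with
    | zero => exact (h.apply_symm_apply _).symm
    | succ n ih =>
      obtain ⟨h1, h2⟩ := hx n hn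
      rw [← Complex.ofReal_inv, Complex.coe_smul, Complex.coe_smul] at h2
      rw [pow_succ']
      change _ = h (T ((T ^ n) (h.symm (x 0))))
      rw [hconj, ← ih (by omega), h2, radialRetraction, max_eq_right h1]
  exact ⟨h.symm (x 0), fun n hn => (horbit n hn) ▸ hh _⟩

/-- The weights of a strongly structurally stable shift satisfy an endpoint summation bound. -/
theorem StronglyStructurallyStable.exists_sum_inv_le {p : ℝ≥0∞} [Fact (1 ≤ p)]
    {a w : ℤ → ℝ} (ha : ∀ k, 0 < a k) (hw : ∀ k, w k = a (k - 1) / a k)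
    {Bw : lp (fun _ : ℤ => ℂ) p ≃L[ℂ] lp (fun _ : ℤ => ℂ) p}
    (hBw : ∀ (x : lp (fun _ : ℤ => ℂ) p) (n : ℤ),
      (Bw x : ∀ _ : ℤ, ℂ) n = (w (n + 1) : ℂ) * (x : ∀ _ : ℤ, ℂ) (n + 1))
    (hB : StronglyStructurallyStable Bw) :
    ∃ δ : ℝ, 0 < δ ∧ ∀ (s : ℤ) (N : ℕ),
      δ * ∑ m ∈ Finset.range N, (a (s - m))⁻¹ ≤ (a s)⁻¹ + (a (s - N))⁻¹ := by
  obtain ⟨δ, hδ, H⟩ := hB.exists_shadowing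
  refine ⟨δ, hδ, fun s N => ?_⟩
  have hp : 0 < p := zero_lt_one.trans_le Fact.out
  set ρ := ∑ m ∈ Finset.range (N + 1), (a (s - m))⁻¹
  let V : ℕ → ℝ := fun n => ρ + δ * ∑ m ∈ Finset.range n, (a (s - m))⁻¹
  let x : ℕ → lp (fun _ : ℤ => ℂ) p := fun n => lp.single p (s - n) ((a (s - n) * V n : ℝ) : ℂ)
  have hV (n : ℕ) : ρ ≤ V n := by
    have : 0 ≤ ∑ m ∈ Finset.range n, (a (s - m))⁻¹ :=
      Finset.sum_nonneg fun m _ => (inv_pos.2 (ha _)).le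
    simp only [V]
    nlinarith
  have hV1 (n : ℕ) (hn : n ≤ N) : 1 ≤ a (s - n) * V n := by
    rw [← div_le_iff₀' (ha _), one_div]
    exact (Finset.single_le_sum (f := fun m : ℕ => (a (s - m))⁻¹)
      (fun m _ => (inv_pos.2 (ha _)).le) (Finset.mem_range_succ_iff.2 hn)).trans (hV n)
  have hnorm (n : ℕ) (hn : n ≤ N) : ‖x n‖ = a (s - n) * V n := by
    rw [lp.norm_single hp, Complex.norm_real, Real.norm_of_nonneg (by linarith [hV1 n hn])]
  have hsingle (i : ℤ) (c : ℂ) :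
      Bw (lp.single p i c) = lp.single p (i - 1) ((w i : ℂ) * c) := by
    ext n
    rw [hBw, lp.single_apply, lp.single_apply, Pi.single_apply, Pi.single_apply]
    by_cases hn : n + 1 = i
    · rw [if_pos hn, if_pos (by omega), hn]
    · rw [if_neg hn, if_neg (by omega), mul_zero]
  obtain ⟨z, hz⟩ := H x N fun n hn => by
    refine ⟨(hV1 n hn.le).trans_eq (hnorm n hn.le).symm, ?_⟩
    have han := ha (s - n)
    have hVn : V n ≠ 0 := by
      have := hV1 n hn.le
      rintro h0
      norm_num [h0] at this
    rw [hnorm n hn.le]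
    simp only [x]
    rw [← lp.single_smul, hsingle, hsingle, ← lp.single_smul, ← lp.single_add]
    rw [show s - ((n + 1 : ℕ) : ℤ) = s - n - 1 by push_cast; ring]
    congr 1
    rw [hw, smul_eq_mul, smul_eq_mul]
    norm_cast
    have hVs : V (n + 1) = V n + δ * (a (s - n))⁻¹ := by
      simp only [V, Finset.sum_range_succ]
      ring
    rw [hVs]
    field_simp
  have hpow (n : ℕ) : ((Bw ^ n) z : ∀ _ : ℤ, ℂ) (s - n) = ((a (s - n) / a s : ℝ) : ℂ) * z s := by
    induction n with
    | zero =>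
      change (z : ∀ _ : ℤ, ℂ) (s - ((0 : ℕ) : ℤ)) = _
      simp [(ha s).ne']
    | succ n ih =>
      rw [pow_succ']
      change (Bw ((Bw ^ n) z) : ∀ _ : ℤ, ℂ) _ = _
      rw [hBw, show s - ((n + 1 : ℕ) : ℤ) = s - n - 1 by push_cast; ring, sub_add_cancel, ih, hw,
        ← mul_assoc, ← Complex.ofReal_mul, div_mul_div_cancel₀ (ha _).ne']
  have hbound (n : ℕ) (hn : n ≤ N) : |V n - ((z s).re / a s)| ≤ (a (s - n))⁻¹ := by
    have h1 := (lp.norm_apply_le_norm hp.ne' _ (s - n)).trans (hz n hn)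
    rw [lp.coeFn_sub, Pi.sub_apply, hpow, lp.single_apply_self] at h1
    have h2 := (Complex.abs_re_le_norm _).trans h1
    rw [Complex.sub_re, Complex.ofReal_re, Complex.re_ofReal_mul, div_mul_eq_mul_div,
      mul_div_assoc, ← mul_sub, abs_mul, abs_of_pos (ha _)] at h2
    rwa [← one_div, le_div_iff₀' (ha _)]
  have h0 := abs_le.1 (hbound 0 (Nat.zero_le _))
  have hN := abs_le.1 (hbound N le_rfl)
  simp only [V, Finset.sum_range_zero, Nat.cast_zero, sub_zero] at h0 hN
  linarith [h0.1, hN.2]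

end Shadowing

section Splitting

variable {E : Type*} [NormedAddCommGroup E] [NormedSpace ℂ E] [CompleteSpace E]

/-- Generalized hyperbolicity implies strong structural stability: it suffices to split the identity
as `P + Q` with `T ^ k P` and `T ^ (-k) Q` decaying geometrically. -/
theorem StronglyStructurallyStable.of_splitting {T : E ≃L[ℂ] E} {P Q : E →L[ℂ] E}
    (hPQ : ∀ x, P x + Q x = x) {C r : ℝ} (hC : 0 ≤ C) (hr0 : 0 ≤ r) (hr1 : r < 1)
    (hP : ∀ (k : ℕ) (x : E), ‖(T ^ ((k : ℤ) + 1)) (P x)‖ ≤ C * r ^ k * ‖x‖)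
    (hQ : ∀ (k : ℕ) (x : E), ‖(T ^ (-(k : ℤ))) (Q x)‖ ≤ C * r ^ k * ‖x‖) :
    StronglyStructurallyStable T := by
  let G : ℤ → E →L[ℂ] E := fun k =>
    if 1 ≤ k then ((T ^ (k - 1) : E ≃L[ℂ] E) : E →L[ℂ] E).comp P
    else -((T ^ (k - 1) : E ≃L[ℂ] E) : E →L[ℂ] E).comp Q
  have hGpos (k : ℤ) (hk : 1 ≤ k) (x : E) : G k x = (T ^ (k - 1)) (P x) := by
    simp only [G, if_pos hk]
    rfl
  have hGneg (k : ℤ) (hk : ¬ 1 ≤ k) (x : E) : G k x = -(T ^ (k - 1)) (Q x) := by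
    simp only [G, if_neg hk]
    rfl
  have hT (k : ℤ) (x : E) : T ((T ^ (k - 1)) x) = (T ^ k) x := by
    conv_rhs => rw [← add_sub_cancel 1 k, zpow_one_add]
    rfl
  have hgeom : Summable fun k : ℕ => C * r ^ k :=
    (summable_geometric_of_lt_one hr0 hr1).mul_left C
  refine .of_green_kernel (G := G) (.of_nat_of_neg_add_one ?_ ?_) fun k x => ?_
  · rw [← summable_nat_add_iff 2]
    refine hgeom.of_nonneg_of_le (fun _ => norm_nonneg _) fun k => ?_
    refine ContinuousLinearMap.opNorm_le_bound _ (by positivity) fun x => ?_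
    rw [hGpos _ (by omega), show ((k + 2 : ℕ) : ℤ) - 1 = k + 1 by push_cast; ring]
    exact hP k x
  · refine ((summable_nat_add_iff 2).2 hgeom).of_nonneg_of_le (fun _ => norm_nonneg _) fun k => ?_
    refine ContinuousLinearMap.opNorm_le_bound _ (by positivity) fun x => ?_
    rw [hGneg _ (by omega), norm_neg,
      show -((k : ℤ) + 1) - 1 = -((k + 2 : ℕ) : ℤ) by push_cast; ring]
    exact hQ _ x
  · rcases lt_trichotomy k 0 with hk | rfl | hk
    · rw [hGneg _ (by omega), hGneg _ (by omega), if_neg hk.ne, add_zero, map_neg, hT,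
        add_sub_cancel_right]
    · rw [hGpos _ (by omega), hGneg _ (by omega), if_pos rfl, map_neg, hT]
      change P x = -Q x + x
      rw [eq_neg_add_iff_add_eq, add_comm]
      exact hPQ x
    · rw [hGpos _ (by omega), hGpos _ (by omega), if_neg hk.ne', add_zero, hT,
        add_sub_cancel_right]

end Splitting

section Composition

theorem Equiv.Perm.image_zpow_eq_preimage {X : Type*} (e : Equiv.Perm X) (n : ℤ) (s : Set X) :
    (e ^ n : Equiv.Perm X) '' s = (e ^ (-n) : Equiv.Perm X) ⁻¹' s := by
  rw [zpow_neg]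
  exact Equiv.image_eq_preimage_symm _ _

theorem Equiv.Perm.preimage_zpow_image_zpow {X : Type*} (e : Equiv.Perm X) (n j : ℤ) (s : Set X) :
    (e ^ n : Equiv.Perm X) ⁻¹' ((e ^ j : Equiv.Perm X) '' s) =
      (e ^ (j - n) : Equiv.Perm X) '' s := by
  rw [image_zpow_eq_preimage, image_zpow_eq_preimage, ← preimage_comp, ← Equiv.Perm.coe_mul,
    ← zpow_add, neg_sub, neg_add_eq_sub]

variable {X : Type*} [MeasurableSpace X] {μ : Measure X}

/-- Multiplication by the indicator function of a measurable set, as a linear map on `L^p`. -/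
noncomputable def lpIndicatorLM (μ : Measure X) (p : ℝ≥0∞) {A : Set X} (hA : MeasurableSet A) :
    Lp ℂ p μ →ₗ[ℂ] Lp ℂ p μ where
  toFun f := ((Lp.memLp f).indicator hA).toLp (A.indicator f)
  map_add' f g := by
    rw [← MemLp.toLp_add, MemLp.toLp_eq_toLp_iff, ← Set.indicator_add']
    exact (Lp.coeFn_add f g).indicator
  map_smul' c f := by
    rw [RingHom.id_apply, ← MemLp.toLp_const_smul, MemLp.toLp_eq_toLp_iff]
    exact (Lp.coeFn_smul c f).indicator.trans (.of_eq (Set.indicator_const_smul A c f))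

theorem coeFn_lpIndicatorLM {p : ℝ≥0∞} {A : Set X} (hA : MeasurableSet A) (f : Lp ℂ p μ) :
    (lpIndicatorLM μ p hA f : X → ℂ) =ᵐ[μ] A.indicator f :=
  ((Lp.memLp f).indicator hA).coeFn_toLp

theorem norm_lpIndicatorLM_le {p : ℝ≥0∞} {A : Set X} (hA : MeasurableSet A) (f : Lp ℂ p μ) :
    ‖lpIndicatorLM μ p hA f‖ ≤ ‖f‖ := by
  rw [Lp.norm_def, Lp.norm_def, eLpNorm_congr_ae (coeFn_lpIndicatorLM hA f)]
  exact ENNReal.toReal_mono (Lp.eLpNorm_ne_top f) (eLpNorm_indicator_le _)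

/-- Multiplication by the indicator function of a measurable set, as an operator on `L^p`. -/
noncomputable def lpIndicatorCLM (μ : Measure X) (p : ℝ≥0∞) [Fact (1 ≤ p)] {A : Set X}
    (hA : MeasurableSet A) : Lp ℂ p μ →L[ℂ] Lp ℂ p μ :=
  (lpIndicatorLM μ p hA).mkContinuous 1 fun f => by
    simpa using norm_lpIndicatorLM_le hA f

theorem coeFn_lpIndicatorCLM {p : ℝ≥0∞} [Fact (1 ≤ p)] {A : Set X} (hA : MeasurableSet A)
    (f : Lp ℂ p μ) : (lpIndicatorCLM μ p hA f : X → ℂ) =ᵐ[μ] A.indicator f :=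
  coeFn_lpIndicatorLM hA f

theorem lpIndicatorCLM_add_compl {p : ℝ≥0∞} [Fact (1 ≤ p)] {A : Set X} (hA : MeasurableSet A)
    (f : Lp ℂ p μ) : lpIndicatorCLM μ p hA f + lpIndicatorCLM μ p hA.compl f = f := by
  apply Lp.ext
  filter_upwards [coeFn_lpIndicatorCLM hA f, coeFn_lpIndicatorCLM hA.compl f,
    Lp.coeFn_add (lpIndicatorCLM μ p hA f) (lpIndicatorCLM μ p hA.compl f)] with x h1 h2 h3
  rw [h3, Pi.add_apply, h1, h2]
  exact congrFun (Set.indicator_self_add_compl A f) x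

variable {e : Equiv.Perm X}

theorem Equiv.Perm.quasiMeasurePreserving_zpow (he : Measure.QuasiMeasurePreserving e μ μ)
    (he' : Measure.QuasiMeasurePreserving e.symm μ μ) (n : ℤ) :
    Measure.QuasiMeasurePreserving (e ^ n : Equiv.Perm X) μ μ := by
  induction n with
  | zero => exact Measure.QuasiMeasurePreserving.id μ
  | succ n ih => rw [zpow_add_one]; exact ih.comp he
  | pred n ih => rw [zpow_sub_one]; exact ih.comp he'

theorem coeFn_zpow_ae_eq_comp {p : ℝ≥0∞} [Fact (1 ≤ p)]
    (he : Measure.QuasiMeasurePreserving e μ μ) (he' : Measure.QuasiMeasurePreserving e.symm μ μ)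
    {T : Lp ℂ p μ ≃L[ℂ] Lp ℂ p μ} (hT : ∀ f : Lp ℂ p μ, (T f : X → ℂ) =ᵐ[μ] fun x => f (e x))
    (n : ℤ) (f : Lp ℂ p μ) :
    ((T ^ n) f : X → ℂ) =ᵐ[μ] (f : X → ℂ) ∘ (e ^ n : Equiv.Perm X) := by
  have hT' (f : Lp ℂ p μ) : ((T⁻¹) f : X → ℂ) =ᵐ[μ] (f : X → ℂ) ∘ e.symm := by
    have h := he'.ae_eq (hT (T⁻¹ f))
    have h1 : T (T⁻¹ f) = f := T.apply_symm_apply f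
    rw [h1] at h
    filter_upwards [h] with x hx
    rw [hx]
    simp
  induction n generalizing f with
  | zero => exact .rfl
  | succ n ih =>
    rw [zpow_add_one, add_comm, zpow_one_add]
    exact (ih (T f)).trans ((e.quasiMeasurePreserving_zpow he he' n).ae_eq (hT f))
  | pred n ih =>
    rw [zpow_sub_one, sub_eq_neg_add, zpow_add, zpow_neg_one]
    exact (ih (T⁻¹ f)).trans ((e.quasiMeasurePreserving_zpow he he' (-n)).ae_eq (hT' f))

theorem norm_zpow_lpIndicatorCLM_le {p : ℝ≥0∞} [Fact (1 ≤ p)] (hp : p ≠ ⊤)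
    (he : Measure.QuasiMeasurePreserving e μ μ) (he' : Measure.QuasiMeasurePreserving e.symm μ μ)
    {T : Lp ℂ p μ ≃L[ℂ] Lp ℂ p μ} (hT : ∀ f : Lp ℂ p μ, (T f : X → ℂ) =ᵐ[μ] fun x => f (e x))
    {A : Set X} (hA : MeasurableSet A) {n : ℤ} {D : ℝ≥0∞} (hD : D ≠ ⊤)
    (h : (μ.map (e ^ n : Equiv.Perm X)).restrict A ≤ D • μ) (f : Lp ℂ p μ) :
    ‖(T ^ n) (lpIndicatorCLM μ p hA f)‖ ≤ (D ^ (1 / p.toReal)).toReal * ‖f‖ := by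
  have hq := e.quasiMeasurePreserving_zpow he he' n
  have h1 : ((T ^ n) (lpIndicatorCLM μ p hA f) : X → ℂ) =ᵐ[μ]
      A.indicator f ∘ (e ^ n : Equiv.Perm X) :=
    (coeFn_zpow_ae_eq_comp he he' hT n _).trans (hq.ae_eq (coeFn_lpIndicatorCLM hA f))
  have hm : AEStronglyMeasurable (A.indicator f) (μ.map (e ^ n : Equiv.Perm X)) :=
    ((Lp.aestronglyMeasurable f).indicator hA).mono_ac hq.absolutelyContinuous
  rw [Lp.norm_def, Lp.norm_def, ← ENNReal.toReal_mul, eLpNorm_congr_ae h1,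
    ← eLpNorm_map_measure hm hq.aemeasurable, eLpNorm_indicator_eq_eLpNorm_restrict hA]
  refine ENNReal.toReal_mono (ENNReal.mul_ne_top
    (ENNReal.rpow_ne_top_of_nonneg (by positivity) hD) (Lp.eLpNorm_ne_top f)) ?_
  refine (eLpNorm_mono_measure _ h).trans_eq ?_
  rw [eLpNorm_smul_measure_of_ne_top hp, smul_eq_mul]
  simp

variable {W : Set X} {K D : ℝ≥0∞}

/-- Bounded distortion transfers a bound on the measures of two iterates of `W` to subsets. -/
theorem measure_preimage_zpow_le (hem : ∀ n : ℤ, Measurable (e ^ n : Equiv.Perm X))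
    (hW0 : 0 < μ W) (hWfin : μ W ≠ ⊤) (hK0 : 0 < K) (hKT : K ≠ ⊤)
    (hbd : ∀ (k : ℤ) (B : Set X), MeasurableSet B → B ⊆ W →
        K⁻¹ * (μ (⇑(e ^ k) '' W) * μ B) ≤ μ (⇑(e ^ k) '' B) * μ W ∧
        μ (⇑(e ^ k) '' B) * μ W ≤ K * (μ (⇑(e ^ k) '' W) * μ B))
    {j n : ℤ} (hD : μ (⇑(e ^ (j - n)) '' W) ≤ D * μ (⇑(e ^ j) '' W)) {B : Set X}
    (hB : MeasurableSet B) (hBW : B ⊆ ⇑(e ^ j) '' W) :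
    μ (⇑(e ^ n) ⁻¹' B) ≤ K ^ 2 * D * μ B := by
  obtain ⟨B', hB'W, rfl⟩ := subset_image_iff.1 hBW
  have hB' : MeasurableSet B' := by
    simpa [preimage_image_eq _ (e ^ j : Equiv.Perm X).injective] using hem j hB
  have h1 := ENNReal.inv_mul_le_iff hK0.ne' hKT |>.1 (hbd j B' hB' hB'W).1
  have h2 := (hbd (j - n) B' hB' hB'W).2
  rw [Equiv.Perm.preimage_zpow_image_zpow, ← ENNReal.mul_le_mul_iff_left hW0.ne' hWfin]
  calc μ (⇑(e ^ (j - n)) '' B') * μ W ≤ K * (μ (⇑(e ^ (j - n)) '' W) * μ B') := h2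
    _ ≤ K * (D * μ (⇑(e ^ j) '' W) * μ B') := by gcongr
    _ = K * D * (μ (⇑(e ^ j) '' W) * μ B') := by ring
    _ ≤ K * D * (K * (μ (⇑(e ^ j) '' B') * μ W)) := by gcongr
    _ = K ^ 2 * D * μ (⇑(e ^ j) '' B') * μ W := by ring

theorem map_zpow_restrict_le (hem : ∀ n : ℤ, Measurable (e ^ n : Equiv.Perm X))
    (hWm : MeasurableSet W) (hW0 : 0 < μ W) (hWfin : μ W ≠ ⊤)
    (hdisj : Pairwise (fun k l : ℤ => Disjoint (⇑(e ^ k) '' W) (⇑(e ^ l) '' W)))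
    (hK0 : 0 < K) (hKT : K ≠ ⊤)
    (hbd : ∀ (k : ℤ) (B : Set X), MeasurableSet B → B ⊆ W →
        K⁻¹ * (μ (⇑(e ^ k) '' W) * μ B) ≤ μ (⇑(e ^ k) '' B) * μ W ∧
        μ (⇑(e ^ k) '' B) * μ W ≤ K * (μ (⇑(e ^ k) '' W) * μ B))
    {I : Set ℤ} {n : ℤ} (hD : ∀ j ∈ I, μ (⇑(e ^ (j - n)) '' W) ≤ D * μ (⇑(e ^ j) '' W))
    {A : Set X} (hA : MeasurableSet A) (hAI : A ⊆ ⋃ j : I, ⇑(e ^ (j : ℤ)) '' W) :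
    (μ.map (e ^ n : Equiv.Perm X)).restrict A ≤ (K ^ 2 * D) • μ := by
  refine Measure.le_iff.2 fun s hs => ?_
  have himage (j : ℤ) : MeasurableSet (⇑(e ^ j) '' W) := by
    rw [Equiv.Perm.image_zpow_eq_preimage]
    exact hem _ hWm
  rw [Measure.restrict_apply hs, Measure.map_apply (hem n) (hs.inter hA), Measure.smul_apply,
    smul_eq_mul]
  have hsub : s ∩ A ⊆ ⋃ j : I, s ∩ ⇑(e ^ (j : ℤ)) '' W := by
    rw [← inter_iUnion]
    exact inter_subset_inter_right _ hAI
  calc μ (⇑(e ^ n) ⁻¹' (s ∩ A))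
      ≤ μ (⋃ j : I, ⇑(e ^ n) ⁻¹' (s ∩ ⇑(e ^ (j : ℤ)) '' W)) := by
        rw [← preimage_iUnion]
        exact measure_mono (preimage_mono hsub)
    _ ≤ ∑' j : I, μ (⇑(e ^ n) ⁻¹' (s ∩ ⇑(e ^ (j : ℤ)) '' W)) := measure_iUnion_le _
    _ ≤ ∑' j : I, K ^ 2 * D * μ (s ∩ ⇑(e ^ (j : ℤ)) '' W) :=
        ENNReal.tsum_le_tsum fun j => measure_preimage_zpow_le hem hW0 hWfin hK0 hKT hbd
          (hD j j.2) (hs.inter (himage j)) inter_subset_right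
    _ = K ^ 2 * D * μ (⋃ j : I, s ∩ ⇑(e ^ (j : ℤ)) '' W) := by
        rw [ENNReal.tsum_mul_left, measure_iUnion ?_ fun j : I => hs.inter (himage j)]
        exact fun i j hij => (hdisj (Subtype.coe_injective.ne hij)).mono inter_subset_right
          inter_subset_right
    _ ≤ K ^ 2 * D * μ s := by
        gcongr
        exact iUnion_subset fun _ => inter_subset_left

end Composition

/-- Theorem W: if the bilateral weighted backward shift `B_w` on `ℓ^p(ℤ)` with
weights `w_k = (μ(f^{k-1}(W))/μ(f^k(W)))^{1/p}` is strongly structurally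
stable, then so is `T_f`. -/
theorem stmt_14
    {X : Type*} [MeasurableSpace X] (μ : MeasureTheory.Measure X) [MeasureTheory.SigmaFinite μ]
    (p : ℝ≥0∞) (hp1 : 1 ≤ p) (hpT : p ≠ ⊤)
    (e : Equiv.Perm X) (he : Measurable e) (he' : Measurable e.symm)
    (c c' : ℝ≥0∞) (hc : 0 < c) (hcT : c ≠ ⊤) (hc' : 0 < c') (hc'T : c' ≠ ⊤)
    (hb : ∀ B : Set X, MeasurableSet B → μ (⇑e ⁻¹' B) ≤ c * μ B)
    (hb' : ∀ B : Set X, MeasurableSet B → μ (⇑e '' B) ≤ c' * μ B)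
    (W : Set X) (hWm : MeasurableSet W) (hW0 : 0 < μ W) (hWfin : μ W ≠ ⊤)
    (hcover : (⋃ k : ℤ, ⇑(e ^ k) '' W) = Set.univ)
    (hdisj : Pairwise (fun k l : ℤ => Disjoint (⇑(e ^ k) '' W) (⇑(e ^ l) '' W)))
    (K : ℝ≥0∞) (hK0 : 0 < K) (hKT : K ≠ ⊤)
    (hbd : ∀ (k : ℤ) (B : Set X), MeasurableSet B → B ⊆ W →
        K⁻¹ * (μ (⇑(e ^ k) '' W) * μ B) ≤ μ (⇑(e ^ k) '' B) * μ W ∧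
        μ (⇑(e ^ k) '' B) * μ W ≤ K * (μ (⇑(e ^ k) '' W) * μ B))
    [Fact (1 ≤ p)]
    (T : MeasureTheory.Lp ℂ p μ ≃L[ℂ] MeasureTheory.Lp ℂ p μ)
    (hT : ∀ φ : MeasureTheory.Lp ℂ p μ, (T φ : X → ℂ) =ᵐ[μ] fun x => φ (e x))
    (w : ℤ → ℝ)
    (hw : ∀ k : ℤ, w k =
      ((μ (⇑(e ^ (k - 1)) '' W) / μ (⇑(e ^ k) '' W)).toReal) ^ (1 / p.toReal))
    (Bw : lp (fun _ : ℤ => ℂ) p ≃L[ℂ] lp (fun _ : ℤ => ℂ) p)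
    (hBw : ∀ (x : lp (fun _ : ℤ => ℂ) p) (n : ℤ),
      (Bw x : ∀ _ : ℤ, ℂ) n = (w (n + 1) : ℂ) * (x : ∀ _ : ℤ, ℂ) (n + 1))
    (hSS : StronglyStructurallyStable Bw) :
    StronglyStructurallyStable T := by
  have hqe : Measure.QuasiMeasurePreserving e μ μ :=
    ⟨he, .mk fun s hs h0 => by
      rw [Measure.map_apply he hs]
      exact le_antisymm ((hb s hs).trans_eq (by rw [h0, mul_zero])) zero_le⟩
  have hqe' : Measure.QuasiMeasurePreserving e.symm μ μ :=
    ⟨he', .mk fun s hs h0 => by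
      rw [Measure.map_apply he' hs, ← Equiv.image_eq_preimage_symm]
      exact le_antisymm ((hb' s hs).trans_eq (by rw [h0, mul_zero])) zero_le⟩
  have hq := e.quasiMeasurePreserving_zpow hqe hqe'
  have hem (n : ℤ) : Measurable (e ^ n : Equiv.Perm X) := (hq n).measurable
  have himage (j : ℤ) : MeasurableSet (⇑(e ^ j) '' W) := by
    rw [Equiv.Perm.image_zpow_eq_preimage]
    exact hem _ hWm
  have hmpos (j : ℤ) : μ (⇑(e ^ j) '' W) ≠ 0 := fun h0 => hW0.ne' <| by
    simpa [preimage_image_eq _ (e ^ j : Equiv.Perm X).injective] using (hq j).preimage_null h0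
  have hmfin (j : ℤ) : μ (⇑(e ^ j) '' W) ≠ ⊤ := by
    induction j with
    | zero => simpa using hWfin
    | succ j ih =>
      rw [add_comm, zpow_one_add, Equiv.Perm.coe_mul, image_comp]
      exact ne_top_of_le_ne_top (ENNReal.mul_ne_top hc'T ih) (hb' _ (himage _))
    | pred j ih =>
      rw [← Equiv.Perm.preimage_zpow_image_zpow, zpow_one]
      exact ne_top_of_le_ne_top (ENNReal.mul_ne_top hcT ih) (hb _ (himage _))
  have hp0 : 0 < p.toReal := ENNReal.toReal_pos (zero_lt_one.trans_le hp1).ne' hpT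
  let a : ℤ → ℝ := fun j => (μ (⇑(e ^ j) '' W)).toReal ^ (1 / p.toReal)
  have ha (j : ℤ) : 0 < a j := Real.rpow_pos_of_pos (ENNReal.toReal_pos (hmpos j) (hmfin j)) _
  have hwa (k : ℤ) : w k = a (k - 1) / a k := by
    rw [hw, ENNReal.toReal_div, Real.div_rpow ENNReal.toReal_nonneg ENNReal.toReal_nonneg]
  obtain ⟨δ, hδ, hsum⟩ := hSS.exists_sum_inv_le ha hwa hBw
  obtain ⟨C, r, hC, hr0, hr1, hgrow⟩ := exists_geometric_growth (q := fun n => (a (-n))⁻¹)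
    (fun n => inv_pos.2 (ha _)) hδ fun l N => by
      simpa [sub_eq_add_neg, add_comm] using hsum (-l) N
  have hinv {x y t : ℝ} (hx : 0 < x) (hy : 0 < y) (h : x⁻¹ ≤ t * y⁻¹) : y ≤ t * x := by
    rwa [← div_eq_mul_inv, le_div_iff₀ hy, inv_mul_le_iff₀ hx, mul_comm] at h
  let I : Set ℤ := {j | ∀ k : ℕ, a (j - (k + 1)) ≤ C * r ^ k * a j}
  have hI (j : ℤ) (hj : j ∈ Iᶜ) (k : ℕ) : a (j - -k) ≤ C * r ^ k * a j := by
    rcases hgrow (-j) with h | h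
    · refine absurd (fun k => hinv (ha _) (ha _) ?_) hj
      convert h k using 4 <;> ring_nf
    · refine hinv (ha _) (ha _) ?_
      convert h k using 4 <;> ring_nf
  have hmeas {i j : ℤ} {t : ℝ} (ht : 0 ≤ t) (h : a i ≤ t * a j) :
      μ (⇑(e ^ i) '' W) ≤ ENNReal.ofReal t ^ p.toReal * μ (⇑(e ^ j) '' W) := by
    have h1 := ENNReal.ofReal_le_ofReal h
    rw [ENNReal.ofReal_mul ht, ← ENNReal.ofReal_rpow_of_nonneg ENNReal.toReal_nonneg (by positivity),
      ← ENNReal.ofReal_rpow_of_nonneg ENNReal.toReal_nonneg (by positivity),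
      ENNReal.ofReal_toReal (hmfin _), ENNReal.ofReal_toReal (hmfin _)] at h1
    have h2 := ENNReal.rpow_le_rpow h1 hp0.le
    rwa [ENNReal.mul_rpow_of_nonneg _ _ hp0.le, ← ENNReal.rpow_mul, ← ENNReal.rpow_mul,
      one_div_mul_cancel hp0.ne', ENNReal.rpow_one, ENNReal.rpow_one] at h2
  set κ := ((K ^ 2) ^ (1 / p.toReal)).toReal
  have hbound {J : Set ℤ} {A : Set X} (hA : MeasurableSet A)
      (hAJ : A ⊆ ⋃ j : J, ⇑(e ^ (j : ℤ)) '' W) {n : ℤ} {t : ℝ} (ht : 0 ≤ t)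
      (h : ∀ j ∈ J, a (j - n) ≤ t * a j) (f : Lp ℂ p μ) :
      ‖(T ^ n) (lpIndicatorCLM μ p hA f)‖ ≤ κ * t * ‖f‖ := by
    have hle := map_zpow_restrict_le hem hWm hW0 hWfin hdisj hK0 hKT hbd
      (fun j hj => hmeas ht (h j hj)) hA hAJ
    refine (norm_zpow_lpIndicatorCLM_le hpT hqe hqe' hT hA (ENNReal.mul_ne_top (by finiteness)
      (ENNReal.rpow_ne_top_of_nonneg hp0.le ENNReal.ofReal_ne_top)) hle f).trans_eq ?_
    rw [ENNReal.mul_rpow_of_nonneg _ _ (by positivity), ← ENNReal.rpow_mul,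
      mul_one_div_cancel hp0.ne', ENNReal.rpow_one, ENNReal.toReal_mul, ENNReal.toReal_ofReal ht]
  have hA : MeasurableSet (⋃ j : I, ⇑(e ^ (j : ℤ)) '' W) := .iUnion fun j => himage j
  have hAc : (⋃ j : I, ⇑(e ^ (j : ℤ)) '' W)ᶜ ⊆ ⋃ j : (Iᶜ : Set ℤ), ⇑(e ^ (j : ℤ)) '' W := by
    intro x hx
    obtain ⟨j, hj⟩ := mem_iUnion.1 (hcover ▸ mem_univ x)
    exact mem_iUnion.2 ⟨⟨j, fun hjI => hx (mem_iUnion.2 ⟨⟨j, hjI⟩, hj⟩)⟩, hj⟩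
  have hκ0 : 0 ≤ κ := ENNReal.toReal_nonneg
  refine .of_splitting (lpIndicatorCLM_add_compl hA) (mul_nonneg hκ0 hC.le) hr0.le hr1
    (fun k f => ?_) fun k f => ?_
  · rw [mul_assoc κ]
    exact hbound hA subset_rfl (by positivity) (fun j hj => hj k) f
  · rw [mul_assoc κ]
    exact hbound hA.compl hAc (by positivity) (fun j hj => hI j hj k) f
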